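/- Avalanche sizes are anticorrelated: in the stationary process of the DSS, let s(t) = Σ_{x=1}^L s(x,t) be the size of the avalanche at time t. Then for every t ≥ 1 and every τ ≥ 1: if 1 ≤ τ ≤ L then Cov(s(t), s(t+τ)) < 0, and if τ ≥ L+1 then Cov(s(t), s(t+τ)) = 0. -/

import Mathlib

namespace DSS

/-- A state of the DSS on `L` sites: a stable field `z : Fin L → Bool` together with a
finite multiset `w` of waiting particles (particles past site `L` have left the system). -/
structure State (L : ℕ) where
  z : Fin L → Bool
  w : Multiset (Fin L)

variable {L : ℕ}

/-- The multiset holding the right neighbour of `x`; empty if the particle leaves the system. -/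
def succSite (L : ℕ) (x : Fin L) : Multiset (Fin L) :=
  if h : x.val + 1 < L then {(⟨x.val + 1, h⟩ : Fin L)} else 0

/-- Evolution of a waiting particle at `x` when `z x = 1`: the waiting particle moves to
`x+1` and the stable particle at `x` becomes a waiting particle at `x`. -/
def topple (s : State L) (x : Fin L) : State L :=
  ⟨Function.update s.z x false, s.w + succSite L x⟩

/-- Evolution of a waiting particle at `x` when `z x = 0`, settling branch (probability p). -/
def settle (s : State L) (x : Fin L) : State L :=
  ⟨Function.update s.z x true, s.w.erase x⟩

/-- Evolution of a waiting particle at `x` when `z x = 0`, jumping branch (probability q). -/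
def jump (s : State L) (x : Fin L) : State L :=
  ⟨s.z, s.w.erase x + succSite L x⟩

/-- `stabilizeAux p q R n s c` is the probability that, evolving one waiting particle at a
time (the particle being selected by the rule `R`), the process started from `s` reaches
within `n` elementary steps a stable state whose stable field is `c`. -/
noncomputable def stabilizeAux (p q : ℝ) (R : State L → Option (Fin L)) :
    ℕ → State L → (Fin L → Bool) → ℝ
  | 0, s, c => if s.w = 0 ∧ s.z = c then 1 else 0
  | n + 1, s, c =>
    match R s with
    | none => if s.z = c then 1 else 0
    | some x =>
      if s.z x then stabilizeAux p q R n (topple s x) c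
      else p * stabilizeAux p q R n (settle s x) c
        + q * stabilizeAux p q R n (jump s x) c

/-- The canonical evolution rule: evolve the leftmost waiting particle. -/
def minRule (s : State L) : Option (Fin L) :=
  if h : s.w = 0 then none
  else some (s.w.toFinset.min'
    (Finset.nonempty_iff_ne_empty.mpr (by simpa [Multiset.toFinset_eq_empty] using h)))

/-- A termination measure: the stabilization process started from `s` ends after at most
`fuel s` elementary steps, whatever the rule and the randomness. -/
def potential (s : State L) : ℕ :=
  (s.w.map fun x => L + 1 - x.val).sum + ∑ x : Fin L, (if s.z x then L + 1 - x.val else 0)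

def fuel (s : State L) : ℕ := 2 * potential s + Multiset.card s.w

/-- Add one waiting particle at site `1` (index `0`). -/
def addGrain (r : Fin L → Bool) : State L :=
  ⟨r, if h : 0 < L then {(⟨0, h⟩ : Fin L)} else 0⟩

/-- The driven-dissipative transition kernel `W` of the DSS: add a particle at site 1 and
stabilize. -/
noncomputable def Wker (p q : ℝ) (r r' : Fin L → Bool) : ℝ :=
  stabilizeAux p q minRule (fuel (addGrain r)) (addGrain r) r'

/-- `W` as a matrix on stable configurations. -/
noncomputable def Wmat (p q : ℝ) (L : ℕ) :
    Matrix (Fin L → Bool) (Fin L → Bool) ℝ :=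
  Matrix.of fun r r' => Wker p q r r'

/-- The product Bernoulli(p) measure `ψ(r) = p^(Σ r) q^(L - Σ r)`. -/
noncomputable def psi (p q : ℝ) {L : ℕ} (r : Fin L → Bool) : ℝ :=
  p ^ (Finset.univ.filter fun x => r x = true).card *
    q ^ (L - (Finset.univ.filter fun x => r x = true).card)



/-- Same as `stabilizeAux`, additionally recording the number of topplings performed at each
site: `stabilizeSAux p q R n s c k` is the probability that the process started from `s`
terminates within `n` steps on the stable field `c` having performed exactly `k x`
topplings (transfers of a waiting particle from `x` to `x+1`) at each site `x`. -/
noncomputable def stabilizeSAux (p q : ℝ) (R : State L → Option (Fin L)) :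
    ℕ → State L → (Fin L → Bool) → (Fin L → ℕ) → ℝ
  | 0, s, c, k => if s.w = 0 ∧ s.z = c ∧ k = 0 then 1 else 0
  | n + 1, s, c, k =>
    match R s with
    | none => if s.z = c ∧ k = 0 then 1 else 0
    | some x =>
      if s.z x then
        (if k x = 0 then 0
          else stabilizeSAux p q R n (topple s x) c (Function.update k x (k x - 1)))
      else
        p * stabilizeSAux p q R n (settle s x) c k
          + q * (if k x = 0 then 0
              else stabilizeSAux p q R n (jump s x) c (Function.update k x (k x - 1)))

/-- Joint avalanche kernel: `Kker p q r r' k` is the probability that, adding one particle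
at site 1 to the stable configuration `r`, the resulting avalanche leads to the stable
configuration `r'` with exactly `k x` topplings at each site `x`. -/
noncomputable def Kker (p q : ℝ) (r r' : Fin L → Bool) (k : Fin L → ℕ) : ℝ :=
  stabilizeSAux p q minRule (fuel (addGrain r)) (addGrain r) r' k

/-- `E[s(x,t)]`: expectation of the number of topplings at site `x` in the `t`-th avalanche
(`t ≥ 1`), for the stationary process started from `ψ`. -/
noncomputable def meanS (p q : ℝ) (L : ℕ) (t : ℕ) (x : Fin L) : ℝ :=
  ∑ r0 : Fin L → Bool, ∑ r1 : Fin L → Bool, ∑ r2 : Fin L → Bool,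
    ∑' k : Fin L → ℕ,
      psi p q r0 * ((Wmat p q L) ^ (t - 1)) r0 r1 * Kker p q r1 r2 k * (k x : ℝ)

/-- `E[s(x,t) s(x',t+τ)]` (`t, τ ≥ 1`) for the stationary process started from `ψ`. -/
noncomputable def corrS (p q : ℝ) (L : ℕ) (t τ : ℕ) (x x' : Fin L) : ℝ :=
  ∑ r0 : Fin L → Bool, ∑ r1 : Fin L → Bool, ∑ r2 : Fin L → Bool,
    ∑ r3 : Fin L → Bool, ∑ r4 : Fin L → Bool,
      ∑' k1 : Fin L → ℕ, ∑' k2 : Fin L → ℕ,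
        psi p q r0 * ((Wmat p q L) ^ (t - 1)) r0 r1 *
          Kker p q r1 r2 k1 * (k1 x : ℝ) *
          ((Wmat p q L) ^ (τ - 1)) r2 r3 *
          Kker p q r3 r4 k2 * (k2 x' : ℝ)


/-- `E[s(t)]` for the avalanche size `s(t) = Σ_x s(x,t)` in the stationary process. -/
noncomputable def meanStot (p q : ℝ) (L : ℕ) (t : ℕ) : ℝ :=
  ∑ r0 : Fin L → Bool, ∑ r1 : Fin L → Bool, ∑ r2 : Fin L → Bool,
    ∑' k : Fin L → ℕ,
      psi p q r0 * ((Wmat p q L) ^ (t - 1)) r0 r1 * Kker p q r1 r2 k *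
        ((∑ x : Fin L, k x : ℕ) : ℝ)

/-- `E[s(t) s(t+τ)]` for the avalanche sizes in the stationary process. -/
noncomputable def corrStot (p q : ℝ) (L : ℕ) (t τ : ℕ) : ℝ :=
  ∑ r0 : Fin L → Bool, ∑ r1 : Fin L → Bool, ∑ r2 : Fin L → Bool,
    ∑ r3 : Fin L → Bool, ∑ r4 : Fin L → Bool,
      ∑' k1 : Fin L → ℕ, ∑' k2 : Fin L → ℕ,
        psi p q r0 * ((Wmat p q L) ^ (t - 1)) r0 r1 *
          Kker p q r1 r2 k1 * ((∑ x : Fin L, k1 x : ℕ) : ℝ) *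
          ((Wmat p q L) ^ (τ - 1)) r2 r3 *
          Kker p q r3 r4 k2 * ((∑ x : Fin L, k2 x : ℕ) : ℝ)

open scoped Matrix

/-- The Bernoulli weight of one site. -/
def siteWeight (p q : ℝ) (b : Bool) : ℝ := if b then p else q

/-- The restriction of a field to all sites but the first. -/
def rest {α : Type*} {L : ℕ} (f : Fin (L + 1) → α) : Fin L → α := fun y => f y.succ

theorem rest_update_zero {α : Type*} {L : ℕ} (f : Fin (L + 1) → α) (a : α) :
    rest (Function.update f 0 a) = rest f := by
  funext y; simp [rest]

theorem rest_update_succ {α : Type*} {L : ℕ} (f : Fin (L + 1) → α) (x : Fin L) (a : α) :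
    rest (Function.update f x.succ a) = Function.update (rest f) x a := by
  funext y; simp [rest, Function.update_apply]

theorem cons_rest {α : Type*} {L : ℕ} (f : Fin (L + 1) → α) :
    (Fin.cons (f 0) (rest f) : Fin (L + 1) → α) = f := Fin.cons_self_tail f

/-- The occupation numbers `a` with one more particle at position `m` (which is lost if the
position lies beyond the last site). -/
def addAt {L : ℕ} (a : Fin L → ℕ) (m : ℕ) : Fin L → ℕ := fun y => a y + if y.val = m then 1 else 0

theorem addAt_succ_zero {L : ℕ} (a : Fin (L + 1) → ℕ) (m : ℕ) : addAt a (m + 1) 0 = a 0 := by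
  simp [addAt]

theorem rest_addAt_zero {L : ℕ} (a : Fin (L + 1) → ℕ) : rest (addAt a 0) = rest a := by
  funext y; simp [rest, addAt]

theorem rest_addAt_succ {L : ℕ} (a : Fin (L + 1) → ℕ) (m : ℕ) :
    rest (addAt a (m + 1)) = addAt (rest a) m := by
  funext y; simp [rest, addAt]

/-- The law of the stable field `c` reached from the field `z` when `n` waiting particles enter
at the first site and `a x` further waiting particles sit at each site `x`; the sites are
stabilized from left to right. -/
noncomputable def sweep (p q : ℝ) :
    (L : ℕ) → ℕ → (Fin L → ℕ) → (Fin L → Bool) → (Fin L → Bool) → ℝ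
  | 0, _, _, _, _ => 1
  | L + 1, n, a, z, c =>
    if n + a 0 = 0 then
      if c 0 = z 0 then sweep p q L 0 (rest a) (rest z) (rest c) else 0
    else siteWeight p q (c 0) *
      sweep p q L (n + a 0 + (z 0).toNat - (c 0).toNat) (rest a) (rest z) (rest c)

theorem sweep_addAt_zero (p q : ℝ) {L : ℕ} (n : ℕ) (a : Fin L → ℕ) (z c : Fin L → Bool) :
    sweep p q L n (addAt a 0) z c = sweep p q L (n + 1) a z c := by
  cases L with
  | zero => rfl
  | succ L =>
    have h : n + addAt a 0 0 = n + 1 + a 0 := by simp [addAt]; omega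
    simp only [sweep, rest_addAt_zero, h]

theorem sweep_topple (p q : ℝ) {L : ℕ} (n : ℕ) (a : Fin L → ℕ) (z c : Fin L → Bool) (x : Fin L)
    (hz : z x = true) (ha : 0 < a x) :
    sweep p q L n (addAt a (x.val + 1)) (Function.update z x false) c = sweep p q L n a z c := by
  induction L generalizing n with
  | zero => exact x.elim0
  | succ L ih =>
    simp only [sweep, rest_addAt_succ, addAt_succ_zero]
    cases x using Fin.cases with
    | zero =>
      have hm : n + a 0 ≠ 0 := by omega
      have hc : (c 0).toNat ≤ 1 := Bool.toNat_le _
      have e : n + a 0 + 1 - (c 0).toNat = n + a 0 - (c 0).toNat + 1 := by omega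
      simp only [Fin.val_zero, if_false, add_zero, hm, hz, e, rest_update_zero,
        sweep_addAt_zero, Function.update_self, Bool.toNat_false, Bool.toNat_true]
    | succ x =>
      have hh := fun m => ih m (rest a) (rest z) (rest c) x hz ha
      simp [rest_update_succ, (Fin.succ_ne_zero x).symm, hh]

theorem sweep_settle_add_jump {p q : ℝ} (hpq : p + q = 1) {L : ℕ} (n : ℕ) (a : Fin L → ℕ)
    (z c : Fin L → Bool) (x : Fin L) (hz : z x = false) (ha : 0 < a x) :
    p * sweep p q L n (Function.update a x (a x - 1)) (Function.update z x true) c +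
      q * sweep p q L n (addAt (Function.update a x (a x - 1)) (x.val + 1)) z c =
        sweep p q L n a z c := by
  induction L generalizing n with
  | zero => exact x.elim0
  | succ L ih =>
    simp only [sweep, rest_addAt_succ, addAt_succ_zero]
    cases x using Fin.cases with
    | zero =>
      obtain ⟨m, hm⟩ : ∃ m, n + a 0 = m + 1 := ⟨n + a 0 - 1, by omega⟩
      have hm' : n + (a 0 - 1) = m := by omega
      simp only [Function.update_self, rest_update_zero, hm', hm, hz, Fin.val_zero,
        sweep_addAt_zero]
      obtain rfl : q = 1 - p := by linarith
      rcases m with _ | m <;> cases hc : c 0 <;>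
        simp [siteWeight, -mul_eq_mul_left_iff] <;> ring
    | succ x =>
      have hh := fun m => ih m (rest a) (rest z) (rest c) x hz ha
      have hr : rest a x = a x.succ := rfl
      have h0 : (0 : Fin (L + 1)) ≠ x.succ := (Fin.succ_ne_zero x).symm
      simp only [rest_update_succ, ne_eq, h0, not_false_eq_true, Function.update_of_ne,
        Fin.val_succ, ← hh, hr]
      split_ifs <;> ring

theorem sweep_zero (p q : ℝ) {L : ℕ} (z c : Fin L → Bool) :
    sweep p q L 0 (fun _ => 0) z c = if z = c then 1 else 0 := by
  induction L with
  | zero => simp [sweep, Subsingleton.elim z c]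
  | succ L ih =>
    have ht : rest (fun _ : Fin (L + 1) => 0) = fun _ => 0 := rfl
    have hzc : z = c ↔ c 0 = z 0 ∧ rest z = rest c := by
      constructor
      · rintro rfl; exact ⟨rfl, rfl⟩
      · rintro ⟨h0, h1⟩
        rw [← cons_rest z, ← cons_rest c, h0, h1]
    simp only [sweep, ht, ih, hzc]
    simp [ite_and]

theorem count_add_succSite {L : ℕ} (w : Multiset (Fin L)) (x : Fin L) :
    (fun y => (w + succSite L x).count y) = addAt (fun y => w.count y) (x.val + 1) := by
  funext y
  rw [Multiset.count_add, addAt]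
  congr 1
  unfold succSite
  split_ifs with h1 h2 h2
  · simp [Fin.ext_iff, h2]
  · simp [Fin.ext_iff, h2]
  · have := y.isLt; omega
  · simp

theorem count_erase_eq_update {L : ℕ} (w : Multiset (Fin L)) (x : Fin L) :
    (fun y => (w.erase x).count y) =
      Function.update (fun y => w.count y) x (w.count x - 1) := by
  funext y
  by_cases h : y = x
  · subst h; simp
  · simp [h]

theorem eq_zero_of_minRule_eq_none {L : ℕ} {s : State L} (h : minRule s = none) : s.w = 0 := by
  by_contra h0
  simp [minRule, h0] at h

theorem mem_of_minRule_eq_some {L : ℕ} {s : State L} {x : Fin L} (h : minRule s = some x) :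
    x ∈ s.w := by
  unfold minRule at h
  split_ifs at h with h0
  simp only [Option.some.injEq] at h
  rw [← h, ← Multiset.mem_toFinset]
  exact Finset.min'_mem _ _

/-- The total weight of all particles, waiting or stable, when a particle at `x` weighs `f x`. -/
def weight {L : ℕ} (f : Fin L → ℕ) (s : State L) : ℕ :=
  (s.w.map f).sum + ∑ x, if s.z x then f x else 0

theorem sum_update_false {L : ℕ} (f : Fin L → ℕ) {z : Fin L → Bool} {x : Fin L}
    (hz : z x = true) :
    (∑ y, if Function.update z x false y then f y else 0) + f x =
      ∑ y, if z y then f y else 0 := by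
  rw [← Finset.sum_erase_add _ _ (Finset.mem_univ x),
    ← Finset.sum_erase_add Finset.univ (fun y => if z y then f y else 0) (Finset.mem_univ x)]
  simp only [Function.update_self, hz, if_true, Bool.false_eq_true, if_false, add_zero]
  congr 1
  refine Finset.sum_congr rfl fun y hy => ?_
  rw [Function.update_of_ne (Finset.ne_of_mem_erase hy)]

theorem sum_map_erase {L : ℕ} (f : Fin L → ℕ) {w : Multiset (Fin L)} {x : Fin L} (hx : x ∈ w) :
    ((w.erase x).map f).sum + f x = (w.map f).sum := by
  conv_rhs => rw [← Multiset.cons_erase hx]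
  simp [add_comm]

theorem weight_topple {L : ℕ} (f : Fin L → ℕ) {s : State L} {x : Fin L} (hz : s.z x = true) :
    weight f (topple s x) + f x = weight f s + ((succSite L x).map f).sum := by
  rw [weight, weight, ← sum_update_false f hz, topple, Multiset.map_add, Multiset.sum_add]
  ring

theorem weight_settle {L : ℕ} (f : Fin L → ℕ) {s : State L} {x : Fin L} (hz : s.z x = false)
    (hx : x ∈ s.w) : weight f (settle s x) = weight f s := by
  have h : s.z = Function.update (Function.update s.z x true) x false := by simp [← hz]
  rw [weight, weight, ← sum_map_erase f hx, settle]
  conv_rhs => rw [h]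
  rw [← sum_update_false f (z := Function.update s.z x true) (x := x) (by simp)]
  ring

theorem weight_jump {L : ℕ} (f : Fin L → ℕ) {s : State L} {x : Fin L} (hx : x ∈ s.w) :
    weight f (jump s x) + f x = weight f s + ((succSite L x).map f).sum := by
  rw [weight, weight, ← sum_map_erase f hx, jump, Multiset.map_add, Multiset.sum_add]
  ring

theorem sum_map_succSite_add_one_le {L : ℕ} (x : Fin L) :
    ((succSite L x).map fun y : Fin L => L + 1 - y.val).sum + 1 ≤ L + 1 - x.val := by
  have := x.isLt
  unfold succSite
  split_ifs <;> simp <;> omega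

theorem sum_map_succSite_add_one {L : ℕ} (x : Fin L) :
    ((succSite L x).map fun y : Fin L => L - y.val).sum + 1 = L - x.val := by
  have := x.isLt
  unfold succSite
  split_ifs <;> simp <;> omega

theorem card_succSite_le {L : ℕ} (x : Fin L) : (succSite L x).card ≤ 1 := by
  unfold succSite
  split_ifs <;> simp

theorem fuel_eq {L : ℕ} (s : State L) :
    fuel s = 2 * weight (fun x => L + 1 - x.val) s + s.w.card := rfl

theorem fuel_topple_lt {L : ℕ} {s : State L} {x : Fin L} (hz : s.z x = true) :
    fuel (topple s x) < fuel s := by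
  have h1 := weight_topple (fun y : Fin L => L + 1 - y.val) hz
  have h2 := sum_map_succSite_add_one_le x
  have h3 := card_succSite_le x
  have h4 : (topple s x).w.card = s.w.card + (succSite L x).card := Multiset.card_add ..
  rw [fuel_eq, fuel_eq, h4]
  omega

theorem fuel_settle_lt {L : ℕ} {s : State L} {x : Fin L} (hz : s.z x = false) (hx : x ∈ s.w) :
    fuel (settle s x) < fuel s := by
  rw [fuel_eq, fuel_eq, weight_settle _ hz hx]
  exact Nat.add_lt_add_left (Multiset.card_erase_lt_of_mem hx) _

theorem fuel_jump_lt {L : ℕ} {s : State L} {x : Fin L} (hx : x ∈ s.w) :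
    fuel (jump s x) < fuel s := by
  have h1 := weight_jump (fun y : Fin L => L + 1 - y.val) hx
  have h2 := sum_map_succSite_add_one_le x
  have h3 := card_succSite_le x
  have h4 : (jump s x).w.card = (s.w.erase x).card + (succSite L x).card := Multiset.card_add ..
  have h5 := Multiset.card_erase_add_one hx
  rw [fuel_eq, fuel_eq, h4]
  omega

theorem stabilizeAux_eq_sweep {p q : ℝ} (hpq : p + q = 1) {L : ℕ} (n : ℕ) (s : State L)
    (c : Fin L → Bool) (hn : fuel s ≤ n) :
    stabilizeAux p q minRule n s c = sweep p q L 0 (fun x => s.w.count x) s.z c := by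
  induction n generalizing s with
  | zero =>
    have hw : s.w = 0 := by
      rw [← Multiset.card_eq_zero]; unfold fuel at hn; omega
    simp [stabilizeAux, hw, sweep_zero]
  | succ n ih =>
    rw [stabilizeAux]
    split
    · next h => simp [eq_zero_of_minRule_eq_none h, sweep_zero]
    · next x h =>
      have hx := mem_of_minRule_eq_some h
      have hc : 0 < s.w.count x := Multiset.count_pos.2 hx
      split_ifs with hz
      · rw [ih _ (by have := fuel_topple_lt hz; omega),
          ← sweep_topple p q 0 (fun x => s.w.count x) s.z c x hz hc, ← count_add_succSite]
        rfl
      · have hz : s.z x = false := by simpa using hz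
        rw [ih _ (by have := fuel_settle_lt hz hx; omega),
          ih _ (by have := fuel_jump_lt hx; omega),
          ← sweep_settle_add_jump hpq 0 (fun x => s.w.count x) s.z c x hz hc,
          ← count_erase_eq_update, ← count_add_succSite]
        rfl

theorem Wker_eq_sweep {p q : ℝ} (hpq : p + q = 1) {L : ℕ} (r r' : Fin L → Bool) :
    Wker p q r r' = sweep p q L 1 (fun _ => 0) r r' := by
  rw [Wker, stabilizeAux_eq_sweep hpq _ _ _ le_rfl, ← sweep_addAt_zero]
  congr 1
  funext x
  have : 0 < L := by have := x.isLt; omega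
  simp [addGrain, addAt, this, Multiset.count_singleton, Fin.ext_iff]

/-- The number of topplings needed to empty the stable field `z`. -/
def height {L : ℕ} (z : Fin L → Bool) : ℕ := weight (fun y => L - y.val) ⟨z, 0⟩

theorem sum_update_pred {L : ℕ} {k : Fin L → ℕ} {x : Fin L} (hk : k x ≠ 0) :
    ∑ y, Function.update k x (k x - 1) y + 1 = ∑ y, k y := by
  rw [Finset.sum_update_of_mem (Finset.mem_univ x), ← Finset.sum_sdiff (Finset.subset_univ {x}),
    Finset.sum_singleton]
  omega

theorem stabilizeSAux_conservation (p q : ℝ) {L : ℕ} (n : ℕ) (s : State L) (c : Fin L → Bool)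
    (k : Fin L → ℕ) (h : stabilizeSAux p q minRule n s c k ≠ 0) :
    ∑ x, k x + height c = weight (fun x => L - x.val) s := by
  induction n generalizing s k with
  | zero =>
    simp only [stabilizeSAux, ne_eq, ite_eq_right_iff, one_ne_zero, imp_false, not_not] at h
    obtain ⟨hw, rfl, rfl⟩ := h
    simp [height, weight, hw]
  | succ n ih =>
    rw [stabilizeSAux] at h
    split at h
    · next hr =>
      simp only [ne_eq, ite_eq_right_iff, one_ne_zero, imp_false, not_not] at h
      obtain ⟨rfl, rfl⟩ := h
      simp [height, weight, eq_zero_of_minRule_eq_none hr]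
    · next x hr =>
      have hx := mem_of_minRule_eq_some hr
      have hsucc := sum_map_succSite_add_one x
      split_ifs at h with hz hk hk
      · exact absurd rfl h
      · have h1 := ih _ _ h
        have h2 := sum_update_pred hk
        have h3 := weight_topple (fun y : Fin L => L - y.val) hz
        omega
      · rw [← weight_settle _ (by simpa using hz) hx]
        exact ih (settle s x) k (by rintro h0; simp [h0] at h)
      · rcases eq_or_ne (stabilizeSAux p q minRule n (settle s x) c k) 0 with h0 | h0
        · have h1 := ih (jump s x) (Function.update k x (k x - 1))
            (by rintro h0'; simp [h0, h0'] at h)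
          have h2 := sum_update_pred hk
          have h3 := weight_jump (fun y : Fin L => L - y.val) hx
          omega
        · rw [← weight_settle _ (by simpa using hz) hx]
          exact ih (settle s x) k h0

theorem hasSum_shift {L : ℕ} {f : (Fin L → ℕ) → ℝ} {v : ℝ} (hf : HasSum f v) (x : Fin L) :
    HasSum (fun k => if k x = 0 then 0 else f (Function.update k x (k x - 1))) v := by
  have hi : Function.Injective fun k : Fin L → ℕ => Function.update k x (k x + 1) := by
    intro k k' h
    funext y
    have hy := congrFun h y
    by_cases hyx : y = x
    · subst hyx; simpa using hy
    · simpa [hyx] using hy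
  rw [← hi.hasSum_iff]
  · convert hf using 1
    funext k
    simp
  · intro k hk
    by_contra h
    refine hk ⟨Function.update k x (k x - 1), ?_⟩
    have h0 : k x ≠ 0 := fun h0 => h (by simp [h0])
    simp [Nat.sub_add_cancel (Nat.pos_of_ne_zero h0)]

theorem hasSum_stabilizeSAux (p q : ℝ) {L : ℕ} (R : State L → Option (Fin L)) (n : ℕ)
    (s : State L) (c : Fin L → Bool) :
    HasSum (stabilizeSAux p q R n s c) (stabilizeAux p q R n s c) := by
  have key (P : Prop) [Decidable P] :
      HasSum (fun k : Fin L → ℕ => if P ∧ k = 0 then (1 : ℝ) else 0) (if P then 1 else 0) := by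
    by_cases hP : P
    · simpa [hP] using hasSum_ite_eq (0 : Fin L → ℕ) (1 : ℝ)
    · simp [hP]
  induction n generalizing s with
  | zero =>
    convert key (s.w = 0 ∧ s.z = c) using 1
    · funext k; simp [stabilizeSAux, and_assoc]
    · simp [stabilizeAux]
  | succ n ih =>
    cases hR : R s with
    | none =>
      convert key (s.z = c) using 1
      · funext k; simp [stabilizeSAux, hR]
      · simp [stabilizeAux, hR]
    | some x =>
      by_cases hz : s.z x = true
      · convert hasSum_shift (ih (topple s x)) x using 1
        · funext k; simp [stabilizeSAux, hR, hz]
        · simp [stabilizeAux, hR, hz]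
      · have hS : stabilizeSAux p q R (n + 1) s c = fun k =>
            p * stabilizeSAux p q R n (settle s x) c k +
              q * (if k x = 0 then 0 else
                stabilizeSAux p q R n (jump s x) c (Function.update k x (k x - 1))) := by
          funext k; simp [stabilizeSAux, hR, hz]
        have hA : stabilizeAux p q R (n + 1) s c = p * stabilizeAux p q R n (settle s x) c +
            q * stabilizeAux p q R n (jump s x) c := by
          simp [stabilizeAux, hR, hz]
        rw [hS, hA]
        exact ((ih (settle s x)).mul_left p).add ((hasSum_shift (ih (jump s x)) x).mul_left q)

theorem hasSum_Kker_mul {p q : ℝ} (hpq : p + q = 1) {L : ℕ} (hL : 0 < L) (r r' : Fin L → Bool) :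
    HasSum (fun k => Kker p q r r' k * ((∑ x, k x : ℕ) : ℝ))
      (sweep p q L 1 (fun _ => 0) r r' * (L + height r - height r')) := by
  have h := (hasSum_stabilizeSAux p q minRule (fuel (addGrain r)) (addGrain r) r').mul_right
    ((L : ℝ) + height r - height r')
  rw [← Wker_eq_sweep hpq, Wker]
  refine (congrArg (HasSum · _) (funext fun k => ?_)).mpr h
  rw [Kker]
  by_cases hk : stabilizeSAux p q minRule (fuel (addGrain r)) (addGrain r) r' k = 0
  · simp [hk]
  · have hc := stabilizeSAux_conservation p q _ _ _ _ hk
    have hw : weight (fun x => L - x.val) (addGrain r) = L + height r := by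
      simp [weight, height, addGrain, hL]
    rw [hw] at hc
    congr 1
    rw [eq_sub_iff_add_eq]
    exact_mod_cast hc


theorem sum_cons {L : ℕ} (f : (Fin (L + 1) → Bool) → ℝ) :
    ∑ z, f z = ∑ b, ∑ z : Fin L → Bool, f (Fin.cons b z) := by
  rw [← (Fin.consEquiv fun _ => Bool).sum_comp, Fintype.sum_prod_type]
  rfl

theorem sum_sum_cons {L : ℕ} (f : (Fin (L + 1) → Bool) → (Fin (L + 1) → Bool) → ℝ) :
    ∑ z, ∑ c, f z c =
      ∑ b, ∑ d, ∑ z : Fin L → Bool, ∑ c : Fin L → Bool, f (Fin.cons b z) (Fin.cons d c) := by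
  rw [sum_cons]
  refine Finset.sum_congr rfl fun b _ => ?_
  rw [Finset.sum_comm, sum_cons]
  exact Finset.sum_congr rfl fun d _ => Finset.sum_comm

theorem rest_cons {L : ℕ} (b : Bool) (z : Fin L → Bool) :
    rest (Fin.cons b z : Fin (L + 1) → Bool) = z := rfl

theorem sweep_cons_succ (p q : ℝ) {L : ℕ} (n : ℕ) (b d : Bool) (z c : Fin L → Bool) :
    sweep p q (L + 1) (n + 1) (fun _ => 0) (Fin.cons b z) (Fin.cons d c) =
      siteWeight p q d * sweep p q L (n + 1 + b.toNat - d.toNat) (fun _ => 0) z c := by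
  have h : rest (fun _ : Fin (L + 1) => 0) = fun _ => 0 := rfl
  simp [sweep, rest_cons, h]

theorem psi_eq_prod (p q : ℝ) {L : ℕ} (z : Fin L → Bool) :
    psi p q z = ∏ x, siteWeight p q (z x) := by
  have h := Finset.card_filter_add_card_filter_not (s := (Finset.univ : Finset (Fin L)))
    (fun x => z x = true)
  rw [Finset.card_univ, Fintype.card_fin] at h
  simp only [siteWeight, Finset.prod_ite, Finset.prod_const, psi]
  congr 2
  omega

theorem psi_cons (p q : ℝ) {L : ℕ} (b : Bool) (z : Fin L → Bool) :
    psi p q (Fin.cons b z : Fin (L + 1) → Bool) = siteWeight p q b * psi p q z := by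
  simp [psi_eq_prod, Fin.prod_univ_succ]

theorem height_cons {L : ℕ} (b : Bool) (z : Fin L → Bool) :
    height (Fin.cons b z : Fin (L + 1) → Bool) = (L + 1) * b.toNat + height z := by
  cases b <;> simp [height, weight, Fin.sum_univ_succ]

theorem sum_psi {p q : ℝ} (hpq : p + q = 1) (L : ℕ) : ∑ z : Fin L → Bool, psi p q z = 1 := by
  induction L with
  | zero => simp [psi]
  | succ L ih =>
    rw [sum_cons, Fintype.sum_bool]
    simp only [psi_cons, ← Finset.mul_sum, ih]
    simpa [siteWeight] using hpq

theorem sum_sweep {p q : ℝ} (hpq : p + q = 1) {L : ℕ} (n : ℕ) (z : Fin L → Bool) :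
    ∑ c, sweep p q L n (fun _ => 0) z c = 1 := by
  induction L generalizing n with
  | zero => simp [sweep]
  | succ L ih =>
    cases n with
    | zero => simp [sweep_zero]
    | succ n =>
      rw [sum_cons, Fintype.sum_bool, ← cons_rest z]
      simp only [sweep_cons_succ, ← Finset.mul_sum, ih]
      simpa [siteWeight] using hpq

theorem sum_psi_mul_sweep {p q : ℝ} (hpq : p + q = 1) {L : ℕ} (n : ℕ) (c : Fin L → Bool) :
    ∑ z, psi p q z * sweep p q L n (fun _ => 0) z c = psi p q c := by
  induction L generalizing n with
  | zero => simp [psi, sweep]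
  | succ L ih =>
    cases n with
    | zero => simp [sweep_zero]
    | succ n =>
      have h (b d : Bool) (z c : Fin L → Bool) (m : ℕ) : siteWeight p q b * psi p q z *
          (siteWeight p q d * sweep p q L m (fun _ => 0) z c) =
          siteWeight p q b * siteWeight p q d * (psi p q z * sweep p q L m (fun _ => 0) z c) := by
        ring
      rw [sum_cons, Fintype.sum_bool, ← cons_rest c]
      simp only [sweep_cons_succ, psi_cons, h, ← Finset.mul_sum, ih]
      simp only [siteWeight, if_true, Bool.false_eq_true, if_false]
      linear_combination ((if c 0 then p else q) * psi p q (rest c)) * hpq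

/-- Stabilization is abelian: letting in `m` and then `n` particles is the same as letting in
all of them at once. -/
theorem sum_sweep_mul_sweep {p q : ℝ} (hpq : p + q = 1) {L : ℕ} (m n : ℕ) (z c : Fin L → Bool) :
    ∑ y, sweep p q L m (fun _ => 0) z y * sweep p q L n (fun _ => 0) y c =
      sweep p q L (m + n) (fun _ => 0) z c := by
  induction L generalizing m n with
  | zero => simp [sweep]
  | succ L ih =>
    rcases m with _ | m
    · simp [sweep_zero]
    rcases n with _ | n
    · simp [sweep_zero]
    have h (d e : Bool) (z y c : Fin L → Bool) (k l : ℕ) :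
        siteWeight p q d * sweep p q L k (fun _ => 0) z y *
          (siteWeight p q e * sweep p q L l (fun _ => 0) y c) =
        siteWeight p q d * siteWeight p q e *
          (sweep p q L k (fun _ => 0) z y * sweep p q L l (fun _ => 0) y c) := by
      ring
    have hidx (b d e : Bool) : m + 1 + b.toNat - d.toNat + (n + 1 + d.toNat - e.toNat) =
        m + 1 + n + 1 + b.toNat - e.toNat := by
      have := d.toNat_le
      have := e.toNat_le
      omega
    rw [sum_cons, Fintype.sum_bool, ← cons_rest c, ← cons_rest z, ← add_assoc (m + 1) n 1]
    simp only [sweep_cons_succ, h, ← Finset.mul_sum, ih, hidx]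
    rw [← add_mul, ← add_mul]
    simp [siteWeight, hpq]

/-- The transition matrix for letting in `n` particles at the first site. -/
noncomputable def sweepMat (p q : ℝ) (L n : ℕ) : Matrix (Fin L → Bool) (Fin L → Bool) ℝ :=
  Matrix.of fun z c => sweep p q L n (fun _ => 0) z c

theorem sweepMat_mul {p q : ℝ} (hpq : p + q = 1) (L m n : ℕ) :
    sweepMat p q L m * sweepMat p q L n = sweepMat p q L (m + n) := by
  ext z c
  exact sum_sweep_mul_sweep hpq m n z c

theorem Wmat_pow {p q : ℝ} (hpq : p + q = 1) (L n : ℕ) : Wmat p q L ^ n = sweepMat p q L n := by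
  induction n with
  | zero =>
    ext z c
    simp [sweepMat, sweep_zero, Matrix.one_apply]
  | succ n ih =>
    have h : Wmat p q L = sweepMat p q L 1 := by
      ext z c
      exact Wker_eq_sweep hpq z c
    rw [pow_succ, ih, h, sweepMat_mul hpq]

theorem sweepMat_mulVec_one {p q : ℝ} (hpq : p + q = 1) (L n : ℕ) :
    sweepMat p q L n *ᵥ 1 = 1 := by
  funext z
  simpa [Matrix.mulVec, dotProduct, sweepMat] using sum_sweep hpq n z

theorem psi_vecMul_sweepMat {p q : ℝ} (hpq : p + q = 1) (L n : ℕ) :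
    psi p q ᵥ* sweepMat p q L n = psi p q := by
  funext c
  exact sum_psi_mul_sweep hpq n c


/-- The second moment of the drop in `height` when `n` particles enter a
stationary field. -/
noncomputable def sqDrop (p q : ℝ) (L n : ℕ) : ℝ :=
  ∑ z : Fin L → Bool, ∑ c : Fin L → Bool,
    psi p q z * sweep p q L n (fun _ => 0) z c * ((height z : ℝ) - height c) ^ 2

theorem sqDrop_zero_right (p q : ℝ) (L : ℕ) : sqDrop p q L 0 = 0 := by
  refine Finset.sum_eq_zero fun z _ => Finset.sum_eq_zero fun c _ => ?_
  rw [sweep_zero]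
  split_ifs with h
  · simp [h]
  · simp

theorem sum_psi_mul_sweep_mul_sq {p q : ℝ} (hpq : p + q = 1) (L n : ℕ) (a : ℝ) :
    ∑ z : Fin L → Bool, ∑ c : Fin L → Bool,
      psi p q z * sweep p q L n (fun _ => 0) z c * (a + ((height z : ℝ) - height c)) ^ 2 =
        a ^ 2 + sqDrop p q L n := by
  have hsplit (z c : Fin L → Bool) :
      psi p q z * sweep p q L n (fun _ => 0) z c * (a + ((height z : ℝ) - height c)) ^ 2 =
        (a ^ 2 * psi p q z + 2 * a * height z * psi p q z) * sweep p q L n (fun _ => 0) z c -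
          2 * a * height c * (psi p q z * sweep p q L n (fun _ => 0) z c) +
          psi p q z * sweep p q L n (fun _ => 0) z c * ((height z : ℝ) - height c) ^ 2 := by
    ring
  have h1 : ∑ z : Fin L → Bool, ∑ c : Fin L → Bool,
      2 * a * height c * (psi p q z * sweep p q L n (fun _ => 0) z c) =
      ∑ z : Fin L → Bool, 2 * a * height z * psi p q z := by
    rw [Finset.sum_comm]
    simp only [← Finset.mul_sum, sum_psi_mul_sweep hpq]
  simp only [hsplit, Finset.sum_add_distrib, Finset.sum_sub_distrib]
  rw [h1]
  simp only [← Finset.mul_sum, sum_sweep hpq, mul_one, Finset.sum_add_distrib, sum_psi hpq]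
  rw [sqDrop]
  ring

theorem sqDrop_succ_succ {p q : ℝ} (hpq : p + q = 1) (L n : ℕ) :
    sqDrop p q (L + 1) (n + 1) = 2 * p * q * (L + 1) ^ 2 + (p ^ 2 + q ^ 2) * sqDrop p q L (n + 1) +
      p * q * (sqDrop p q L (n + 2) + sqDrop p q L n) := by
  have h (b d : Bool) : ∑ z : Fin L → Bool, ∑ c : Fin L → Bool,
      psi p q (Fin.cons b z : Fin (L + 1) → Bool) *
        sweep p q (L + 1) (n + 1) (fun _ => 0) (Fin.cons b z) (Fin.cons d c) *
        ((height (Fin.cons b z : Fin (L + 1) → Bool) : ℝ) -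
          height (Fin.cons d c : Fin (L + 1) → Bool)) ^ 2 =
      siteWeight p q b * siteWeight p q d * ((((L : ℝ) + 1) * (b.toNat - d.toNat)) ^ 2 +
        sqDrop p q L (n + 1 + b.toNat - d.toNat)) := by
    rw [← sum_psi_mul_sweep_mul_sq hpq, Finset.mul_sum]
    refine Finset.sum_congr rfl fun z _ => ?_
    rw [Finset.mul_sum]
    refine Finset.sum_congr rfl fun c _ => ?_
    rw [psi_cons, sweep_cons_succ, height_cons, height_cons]
    push_cast
    ring
  rw [sqDrop, sum_sum_cons]
  simp only [h, Fintype.sum_bool]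
  simp [siteWeight]
  ring

/-- `sqDrop` is concave in the number of particles, strictly so up to the length of the chain. -/
theorem sqDrop_concave {p q : ℝ} (hp : 0 < p) (hq : 0 < q) (hpq : p + q = 1) (L n : ℕ) :
    (n < L → sqDrop p q L (n + 2) - 2 * sqDrop p q L (n + 1) + sqDrop p q L n < 0) ∧
    (L ≤ n → sqDrop p q L (n + 2) - 2 * sqDrop p q L (n + 1) + sqDrop p q L n = 0) := by
  induction L generalizing n with
  | zero => simp [sqDrop, height, weight]
  | succ L ih =>
    have hpq0 : 0 < p * q := mul_pos hp hq
    have hnonpos (m : ℕ) :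
        sqDrop p q L (m + 2) - 2 * sqDrop p q L (m + 1) + sqDrop p q L m ≤ 0 := by
      rcases lt_or_ge m L with h | h
      · exact ((ih m).1 h).le
      · exact ((ih m).2 h).le
    have hs : 0 < p ^ 2 + q ^ 2 := by positivity
    rcases n with _ | n
    · refine ⟨fun _ => ?_, fun h => by omega⟩
      rw [sqDrop_zero_right, sqDrop_succ_succ hpq, sqDrop_succ_succ hpq]
      have h0 := mul_nonpos_of_nonneg_of_nonpos hs.le (hnonpos 0)
      have h1 := mul_nonpos_of_nonneg_of_nonpos hpq0.le (hnonpos 1)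
      have h2 : 0 < p * q * ((L : ℝ) + 1) ^ 2 := by positivity
      simp only [sqDrop_zero_right, zero_add] at h0 h1 h2 ⊢
      norm_num at h0 h1 h2 ⊢
      linarith
    · have key : sqDrop p q (L + 1) (n + 1 + 2) - 2 * sqDrop p q (L + 1) (n + 1 + 1) +
          sqDrop p q (L + 1) (n + 1) =
          (p ^ 2 + q ^ 2) *
            (sqDrop p q L (n + 1 + 2) - 2 * sqDrop p q L (n + 1 + 1) + sqDrop p q L (n + 1)) +
          p * q * ((sqDrop p q L (n + 2 + 2) - 2 * sqDrop p q L (n + 2 + 1) + sqDrop p q L (n + 2))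
            + (sqDrop p q L (n + 2) - 2 * sqDrop p q L (n + 1) + sqDrop p q L n)) := by
        rw [sqDrop_succ_succ hpq, sqDrop_succ_succ hpq, sqDrop_succ_succ hpq]
        ring_nf
      rw [key]
      refine ⟨fun h => ?_, fun h => ?_⟩
      · have h0 := mul_nonpos_of_nonneg_of_nonpos hs.le (hnonpos (n + 1))
        have h1 := mul_neg_of_pos_of_neg hpq0
          (add_neg_of_nonpos_of_neg (hnonpos (n + 2)) ((ih n).1 (by omega)))
        linarith
      · rw [(ih n).2 (by omega), (ih (n + 1)).2 (by omega), (ih (n + 2)).2 (by omega)]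
        ring

/-- The expectation `E[h(z) h(c)]` of the product of the heights before and after `n` particles
enter a stationary field. -/
noncomputable def heightCorr (p q : ℝ) (L n : ℕ) : ℝ :=
  ∑ z : Fin L → Bool, ∑ c : Fin L → Bool,
    psi p q z * height z * sweep p q L n (fun _ => 0) z c * height c

theorem sqDrop_eq {p q : ℝ} (hpq : p + q = 1) (L n : ℕ) :
    sqDrop p q L n =
      2 * ∑ z : Fin L → Bool, psi p q z * (height z : ℝ) ^ 2 - 2 * heightCorr p q L n := by
  have hsplit (z c : Fin L → Bool) :
      psi p q z * sweep p q L n (fun _ => 0) z c * ((height z : ℝ) - height c) ^ 2 =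
        psi p q z * (height z : ℝ) ^ 2 * sweep p q L n (fun _ => 0) z c +
          (height c : ℝ) ^ 2 * (psi p q z * sweep p q L n (fun _ => 0) z c) -
          2 * (psi p q z * height z * sweep p q L n (fun _ => 0) z c * height c) := by
    ring
  have h1 : ∑ z : Fin L → Bool, ∑ c : Fin L → Bool,
      (height c : ℝ) ^ 2 * (psi p q z * sweep p q L n (fun _ => 0) z c) =
      ∑ z : Fin L → Bool, psi p q z * (height z : ℝ) ^ 2 := by
    rw [Finset.sum_comm]
    simp only [← Finset.mul_sum, sum_psi_mul_sweep hpq, mul_comm]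
  rw [sqDrop]
  simp only [hsplit, Finset.sum_add_distrib, Finset.sum_sub_distrib]
  rw [h1]
  simp only [← Finset.mul_sum, sum_sweep hpq, mul_one, heightCorr]
  ring

/-- The number of topplings during one avalanche, weighted by its probability. -/
noncomputable def sizeMat (p q : ℝ) (L : ℕ) : Matrix (Fin L → Bool) (Fin L → Bool) ℝ :=
  Matrix.of fun z c => sweep p q L 1 (fun _ => 0) z c * (L + height z - height c)

/-- `height` as a real-valued observable. -/
def heightVec (L : ℕ) : (Fin L → Bool) → ℝ := fun z => height z

theorem sizeMat_mulVec_one {p q : ℝ} (hpq : p + q = 1) (L : ℕ) :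
    sizeMat p q L *ᵥ 1 =
      (L : ℝ) • (1 : (Fin L → Bool) → ℝ) + heightVec L - sweepMat p q L 1 *ᵥ heightVec L := by
  funext z
  have h (c : Fin L → Bool) : sweep p q L 1 (fun _ => 0) z c * ((L : ℝ) + height z - height c) =
      ((L : ℝ) + height z) * sweep p q L 1 (fun _ => 0) z c -
        sweep p q L 1 (fun _ => 0) z c * height c := by
    ring
  simp [Matrix.mulVec, dotProduct, sizeMat, sweepMat, heightVec, h, ← Finset.mul_sum,
    sum_sweep hpq]

theorem psi_vecMul_sizeMat {p q : ℝ} (hpq : p + q = 1) (L : ℕ) :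
    psi p q ᵥ* sizeMat p q L = (L : ℝ) • psi p q +
      (psi p q * heightVec L) ᵥ* sweepMat p q L 1 - psi p q * heightVec L := by
  funext c
  have h (z : Fin L → Bool) :
      psi p q z * (sweep p q L 1 (fun _ => 0) z c * ((L : ℝ) + height z - height c)) =
      ((L : ℝ) - height c) * (psi p q z * sweep p q L 1 (fun _ => 0) z c) +
        psi p q z * height z * sweep p q L 1 (fun _ => 0) z c := by
    ring
  simp only [Matrix.vecMul, dotProduct, sizeMat, sweepMat, heightVec, Matrix.of_apply, h,
    Finset.sum_add_distrib, ← Finset.mul_sum, sum_psi_mul_sweep hpq, Pi.add_apply, Pi.sub_apply,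
    Pi.smul_apply, Pi.mul_apply, smul_eq_mul]
  ring

theorem psi_dotProduct_sweepMat_mulVec {p q : ℝ} (hpq : p + q = 1) (L n : ℕ)
    (v : (Fin L → Bool) → ℝ) : psi p q ⬝ᵥ (sweepMat p q L n *ᵥ v) = psi p q ⬝ᵥ v := by
  rw [Matrix.dotProduct_mulVec, psi_vecMul_sweepMat hpq]

theorem psi_dotProduct_one {p q : ℝ} (hpq : p + q = 1) (L : ℕ) :
    psi p q ⬝ᵥ (1 : (Fin L → Bool) → ℝ) = 1 := by
  simpa [dotProduct] using sum_psi hpq L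

theorem meanStot_eq {p q : ℝ} (hpq : p + q = 1) {L : ℕ} (hL : 0 < L) (t : ℕ) :
    meanStot p q L t = L := by
  have h : meanStot p q L t =
      psi p q ⬝ᵥ (sweepMat p q L (t - 1) *ᵥ (sizeMat p q L *ᵥ 1)) := by
    simp only [meanStot, dotProduct, Matrix.mulVec, Finset.mul_sum, Wmat_pow hpq]
    refine Finset.sum_congr rfl fun r0 _ => Finset.sum_congr rfl fun r1 _ =>
      Finset.sum_congr rfl fun r2 _ => ?_
    simp only [mul_assoc, tsum_mul_left, (hasSum_Kker_mul hpq hL r1 r2).tsum_eq, sizeMat,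
      Matrix.of_apply, Pi.one_apply, mul_one]
  rw [h, psi_dotProduct_sweepMat_mulVec hpq, sizeMat_mulVec_one hpq]
  simp [psi_dotProduct_sweepMat_mulVec hpq, psi_dotProduct_one hpq]

theorem corrStot_eq {p q : ℝ} (hpq : p + q = 1) {L : ℕ} (hL : 0 < L) (t n : ℕ) :
    corrStot p q L t (n + 1) = (L : ℝ) ^ 2 +
      (2 * heightCorr p q L (n + 1) - heightCorr p q L (n + 2) - heightCorr p q L n) := by
  have h : corrStot p q L t (n + 1) =
      psi p q ⬝ᵥ (sweepMat p q L (t - 1) *ᵥ (sizeMat p q L *ᵥ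
        (sweepMat p q L n *ᵥ (sizeMat p q L *ᵥ 1)))) := by
    simp only [corrStot, dotProduct, Matrix.mulVec, Finset.mul_sum, Wmat_pow hpq]
    refine Finset.sum_congr rfl fun r0 _ => Finset.sum_congr rfl fun r1 _ =>
      Finset.sum_congr rfl fun r2 _ => Finset.sum_congr rfl fun r3 _ =>
      Finset.sum_congr rfl fun r4 _ => ?_
    simp only [mul_assoc, tsum_mul_left, (hasSum_Kker_mul hpq hL r3 r4).tsum_eq]
    simp only [← mul_assoc, tsum_mul_right]
    simp only [mul_assoc, (hasSum_Kker_mul hpq hL r1 r2).tsum_eq]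
    simp only [sizeMat, Matrix.of_apply, Pi.one_apply, mul_one, Nat.add_sub_cancel]
    ring
  have hE (k : ℕ) : (psi p q * heightVec L) ⬝ᵥ (sweepMat p q L k *ᵥ heightVec L) =
      heightCorr p q L k := by
    simp [heightCorr, dotProduct, Matrix.mulVec, Finset.mul_sum, sweepMat, heightVec, mul_assoc]
  have hE0 (k : ℕ) : psi p q ⬝ᵥ (sweepMat p q L k *ᵥ heightVec L) = psi p q ⬝ᵥ heightVec L :=
    psi_dotProduct_sweepMat_mulVec hpq L k _
  rw [h, psi_dotProduct_sweepMat_mulVec hpq, Matrix.dotProduct_mulVec, psi_vecMul_sizeMat hpq,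
    sizeMat_mulVec_one hpq]
  simp only [add_dotProduct, sub_dotProduct, smul_dotProduct, ← Matrix.dotProduct_mulVec,
    Matrix.mulVec_add, Matrix.mulVec_sub, Matrix.mulVec_smul, Matrix.mulVec_mulVec,
    sweepMat_mul hpq, sweepMat_mulVec_one hpq, dotProduct_add, dotProduct_sub, dotProduct_smul,
    hE, hE0, psi_dotProduct_one hpq, smul_eq_mul, add_comm 1 n, ← add_assoc]
  ring_nf

/-- avalanche sizes are anticorrelated. For `t ≥ 1`, `τ ≥ 1`: if `τ ≤ L`
then `Cov(s(t), s(t+τ)) < 0`, and if `τ ≥ L+1` then `Cov(s(t), s(t+τ)) = 0`. -/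
theorem avalanche_sizes_anticorrelated
    (L : ℕ) (hL : 0 < L) (p q : ℝ) (hp : 0 < p) (hq : 0 < q) (hpq : p + q = 1)
    (t τ : ℕ) (ht : 1 ≤ t) (hτ : 1 ≤ τ) :
    (τ ≤ L → corrStot p q L t τ - meanStot p q L t * meanStot p q L (t + τ) < 0) ∧
    (L + 1 ≤ τ → corrStot p q L t τ - meanStot p q L t * meanStot p q L (t + τ) = 0) := by
  obtain ⟨n, rfl⟩ : ∃ n, τ = n + 1 := ⟨τ - 1, by omega⟩
  have h : corrStot p q L t (n + 1) - meanStot p q L t * meanStot p q L (t + (n + 1)) =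
      (sqDrop p q L (n + 2) - 2 * sqDrop p q L (n + 1) + sqDrop p q L n) / 2 := by
    rw [corrStot_eq hpq hL, meanStot_eq hpq hL, meanStot_eq hpq hL, sqDrop_eq hpq, sqDrop_eq hpq,
      sqDrop_eq hpq]
    ring
  rw [h]
  refine ⟨fun hn => ?_, fun hn => ?_⟩
  · have := (sqDrop_concave hp hq hpq L n).1 (by omega)
    linarith
  · rw [(sqDrop_concave hp hq hpq L n).2 (by omega), zero_div]

end DSS
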